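/- arXiv:1602.01617 — 8 statements merged into one kernel-verified Lean document; each statement's English description precedes it below -/
import Mathlib

section
/- Let A > 1 be an odd number with A ≡ 1 mod 4, and let a_0 = A, a_1, a_2, ... be the sequence of odd numbers in the Collatz sequence of A. Write A = 4N + 1. If N is odd (i.e., A = 2^2·N + 1 with N odd), then a_1 = n_1, where n_1 is the second odd number in the Collatz sequence of N. Moreover, if A = 4^d·P + 4^{d-1} + ... + 4^2 + 4 + 1 with P ≢ 1 mod 4 (so A is a jump from P of maximum height d), then a_1 = (3A+1)/(4^d · 2^i) = (3P+1)/2^i, where i = 1 if P is odd and i = 0 if P is even. -/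
/-- One step of the Collatz map. -/
def collatzStep (n : ℕ) : ℕ := if Odd n then 3 * n + 1 else n / 2

/-- For an odd number `a`, the next odd number occurring in the Collatz
sequence of `a`: `(3a+1)/2^v` where `2^v` is the largest power of `2`
dividing `3a+1`. -/
def nextOdd (a : ℕ) : ℕ := (3 * a + 1) / 2 ^ (3 * a + 1).factorization 2

/-- The sequence of odd numbers in the Collatz sequence of an odd number `A`. -/
def oddSeq (A : ℕ) (i : ℕ) : ℕ := nextOdd^[i] A

/-- Two Collatz sequences merge: they become equal after finitely many terms. -/
def collMerges (A B : ℕ) : Prop := ∃ i j, collatzStep^[i] A = collatzStep^[j] B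

/-- Two Collatz sequences (of odd starting numbers) are equivalent:
the second odd number occurring in each sequence is the same. -/
def collEquiv (A B : ℕ) : Prop := nextOdd A = nextOdd B

/-- `A` is a jump from `P` of height `d`:
`A = 4^d * P + 4^(d-1) + ... + 4 + 1`. -/
def isJump (A P d : ℕ) : Prop := 1 ≤ d ∧ A = 4 ^ d * P + (4 ^ d - 1) / 3

theorem nextOdd_eq_of_odd {a k m : ℕ} (hm : Odd m) (h : 3 * a + 1 = 2 ^ k * m) :
    nextOdd a = m := by
  have hm0 : m ≠ 0 := hm.pos.ne'
  have hf : (2 ^ k * m).factorization 2 = k := by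
    rw [Nat.factorization_mul (by positivity) hm0, Nat.Prime.factorization_pow Nat.prime_two,
      Finsupp.add_apply, Nat.factorization_eq_zero_of_not_dvd hm.not_two_dvd_nat]
    simp
  rw [nextOdd, h, hf, Nat.mul_div_cancel_left _ (by positivity)]

theorem nextOdd_eq_of_pow_mul {a b k : ℕ} (h : 3 * a + 1 = 2 ^ k * (3 * b + 1)) :
    nextOdd a = nextOdd b := by
  obtain ⟨j, m, hm, hj⟩ := Nat.exists_eq_two_pow_mul_odd (n := 3 * b + 1) (by omega)
  rw [nextOdd_eq_of_odd hm hj, nextOdd_eq_of_odd (k := k + j) hm (by rw [h, hj]; ring)]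

theorem isJump.three_mul_add_one {A P d : ℕ} (h : isJump A P d) :
    3 * A + 1 = 4 ^ d * (3 * P + 1) := by
  have hdvd : 3 ∣ 4 ^ d - 1 := by simpa using Nat.sub_dvd_pow_sub_pow 4 1 d
  have hpos : 0 < 4 ^ d := by positivity
  rw [h.2, mul_add, Nat.mul_div_cancel' hdvd, mul_add, mul_left_comm]
  omega

theorem nextOdd_of_mod_four_ne_one {P : ℕ} (hP : P % 4 ≠ 1) :
    nextOdd P = (3 * P + 1) / 2 ^ (if Odd P then 1 else 0) := by
  split_ifs with h
  · have := Nat.odd_iff.mp h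
    exact nextOdd_eq_of_odd (k := 1) (m := (3 * P + 1) / 2 ^ 1) (Nat.odd_iff.mpr (by omega)) (by omega)
  · have := Nat.not_odd_iff.mp h
    exact nextOdd_eq_of_odd (k := 0) (m := (3 * P + 1) / 2 ^ 0) (Nat.odd_iff.mpr (by omega)) (by omega)

theorem stmt2 (A : ℕ) (hA : Odd A) (hA1 : 1 < A) (hA4 : A % 4 = 1) :
    (∀ N, Odd N → A = 2 ^ 2 * N + 1 → oddSeq A 1 = oddSeq N 1) ∧
    (∀ P d, isJump A P d → P % 4 ≠ 1 →
      oddSeq A 1 = (3 * A + 1) / (4 ^ d * 2 ^ (if Odd P then 1 else 0)) ∧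
      oddSeq A 1 = (3 * P + 1) / 2 ^ (if Odd P then 1 else 0)) := by
  refine ⟨fun N _ h => nextOdd_eq_of_pow_mul (k := 2) (by omega), fun P d h hP => ?_⟩
  have hjump := h.three_mul_add_one
  have hnext : oddSeq A 1 = (3 * P + 1) / 2 ^ (if Odd P then 1 else 0) :=
    (nextOdd_eq_of_pow_mul (k := 2 * d) (by rw [hjump, pow_mul]; norm_num)).trans
      (nextOdd_of_mod_four_ne_one hP)
  refine ⟨?_, hnext⟩
  rw [hnext, hjump, Nat.mul_div_mul_left _ _ (by positivity)]
end

section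
/- Let A = 2^k·N + 1 with N odd and k > 2, and let a_0 = A, a_1, a_2, ... be the sequence of odd numbers in the Collatz sequence of A. Write k = 2j + r with r = 0 or r = 1. If r = 0, then a_i = 2^{k-2i}·3^i·N + 1 for i = 1, ..., j-1, and the Collatz sequence of A merges with the Collatz sequence of 3^{j-1}·N. If r = 1, then a_i = 2^{k-2i}·3^i·N + 1 for i = 1, ..., j. -/
theorem nextOdd_four_mul_add_one {x : ℕ} (hx : Even x) : nextOdd (4 * x + 1) = 3 * x + 1 := by
  have hodd : ¬ 2 ∣ 3 * x + 1 := by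
    obtain ⟨y, rfl⟩ := hx
    omega
  have hval : 3 * (4 * x + 1) + 1 = 2 ^ 2 * (3 * x + 1) := by ring
  have hfac : (2 ^ 2 * (3 * x + 1)).factorization 2 = 2 := by
    rw [Nat.factorization_mul (by norm_num) (by omega), Nat.Prime.factorization_pow Nat.prime_two]
    simp [Nat.factorization_eq_zero_of_not_dvd hodd]
  rw [nextOdd, hval, hfac, Nat.mul_div_cancel_left _ (by norm_num)]

theorem collatzStep_of_odd {n : ℕ} (hn : Odd n) : collatzStep n = 3 * n + 1 := if_pos hn

theorem collatzStep_two_mul (n : ℕ) : collatzStep (2 * n) = n := by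
  have h : ¬ Odd (2 * n) := by simp
  rw [collatzStep, if_neg h]
  omega

theorem collatzStep_iterate_three (x : ℕ) : collatzStep^[3] (4 * x + 1) = 3 * x + 1 := by
  have hodd : Odd (4 * x + 1) := ⟨2 * x, by ring⟩
  have hval : 3 * (4 * x + 1) + 1 = 2 * (2 * (3 * x + 1)) := by ring
  simp only [Function.iterate_succ_apply, Function.iterate_zero_apply]
  rw [collatzStep_of_odd hodd, hval, collatzStep_two_mul, collatzStep_two_mul]

/-- A map sending `4 * x + 1` to `3 * x + 1` whenever `2 ^ m ∣ x` trades each factor `4` of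
`2 ^ (m + 2 * i) * M` for a factor `3`. -/
theorem iterate_two_pow_mul_add_one {f : ℕ → ℕ} {m : ℕ}
    (hf : ∀ x, 2 ^ m ∣ x → f (4 * x + 1) = 3 * x + 1) (i M : ℕ) :
    f^[i] (2 ^ (m + 2 * i) * M + 1) = 2 ^ m * 3 ^ i * M + 1 := by
  induction i generalizing M with
  | zero => simp
  | succ i ih =>
    have hval : 2 ^ (m + 2 * (i + 1)) * M + 1 = 4 * (2 ^ m * (2 ^ (2 * i) * M)) + 1 := by ring
    have hstep : 3 * (2 ^ m * (2 ^ (2 * i) * M)) + 1 = 2 ^ (m + 2 * i) * (3 * M) + 1 := by ring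
    rw [Function.iterate_succ_apply, hval, hf _ (dvd_mul_right _ _), hstep, ih]
    ring

theorem oddSeq_two_pow_mul_add_one {k i : ℕ} (h : 2 * i < k) (N : ℕ) :
    oddSeq (2 ^ k * N + 1) i = 2 ^ (k - 2 * i) * 3 ^ i * N + 1 := by
  have key := iterate_two_pow_mul_add_one (f := nextOdd) (m := k - 2 * i)
    (fun x hx ↦ nextOdd_four_mul_add_one
      (even_iff_two_dvd.2 ((dvd_pow_self 2 (by omega)).trans hx))) i N
  rwa [Nat.sub_add_cancel h.le] at key

theorem collMerges_two_pow_mul_add_one {N : ℕ} (hN : Odd N) (i : ℕ) :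
    collMerges (2 ^ (2 + 2 * i) * N + 1) (3 ^ i * N) := by
  have hodd : Odd (3 ^ i * N) := (Odd.pow (by decide)).mul hN
  refine ⟨3 + 3 * i, 1, ?_⟩
  rw [Function.iterate_add_apply, Function.iterate_mul,
    iterate_two_pow_mul_add_one (fun x _ ↦ collatzStep_iterate_three x),
    show 2 ^ 2 * 3 ^ i * N + 1 = 4 * (3 ^ i * N) + 1 by ring, collatzStep_iterate_three,
    Function.iterate_one, collatzStep_of_odd hodd]

theorem stmt3 (A N k j r : ℕ) (hN : Odd N) (hk : 2 < k)
    (hA : A = 2 ^ k * N + 1) (hkjr : k = 2 * j + r) (hr : r = 0 ∨ r = 1) :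
    (r = 0 →
      (∀ i, 1 ≤ i → i ≤ j - 1 → oddSeq A i = 2 ^ (k - 2 * i) * 3 ^ i * N + 1) ∧
      collMerges A (3 ^ (j - 1) * N)) ∧
    (r = 1 →
      ∀ i, 1 ≤ i → i ≤ j → oddSeq A i = 2 ^ (k - 2 * i) * 3 ^ i * N + 1) := by
  subst hA
  refine ⟨fun h0 ↦ ⟨fun i _ hi ↦ oddSeq_two_pow_mul_add_one (by omega) N, ?_⟩,
    fun h1 i _ hi ↦ oddSeq_two_pow_mul_add_one (by omega) N⟩
  have hk' : k = 2 + 2 * (j - 1) := by omega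
  rw [hk']
  exact collMerges_two_pow_mul_add_one hN (j - 1)
end

section
/- Let A be an odd number with A ≡ 0 mod 3, and write A = 3^n·B with n ≥ 1, B odd, and B ≢ 0 mod 3. Let q_i and f_i denote the sequences of odd numbers in the reverse Collatz sequences of 2A + 1 and 4A + 1 respectively. Then for i = 1, 2, ..., n: q_i = 2^{2i+1}·3^{n-i}·B + 1 and f_i = 2^{2i+2}·3^{n-i}·B + 1. If B ≡ 1 mod 3, then q_n ≡ 0 mod 3; if B ≡ 2 mod 3, then f_n ≡ 0 mod 3. -/
def revStep (a : ℕ) : ℕ := if Even a ∧ a % 3 = 1 then (a - 1) / 3 else 2 * a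

/-- For an odd number `a` not divisible by `3`, the next odd number
occurring in the reverse Collatz sequence of `a`. -/
def revNextOdd (a : ℕ) : ℕ := if a % 3 = 2 then (2 * a - 1) / 3 else (4 * a - 1) / 3

/-- The sequence of odd numbers in the reverse Collatz sequence of `A`
(meaningful as long as the previous terms are not divisible by `3`). -/
def revOddSeq (A : ℕ) (i : ℕ) : ℕ := revNextOdd^[i] A

/-- The reverse Collatz sequence of `A` is trivial: `A` is the only odd
number occurring in it. -/
def revTrivial (A : ℕ) : Prop := ∀ i, Odd (revStep^[i] A) → revStep^[i] A = A

/-- The reverse Collatz sequence of `A` converges: its subsequence of odd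
numbers reaches a multiple of `3`. -/
def revConverges (A : ℕ) : Prop := ∃ i, Odd (revStep^[i] A) ∧ 3 ∣ revStep^[i] A

theorem revNextOdd_three_mul_add_one (m : ℕ) : revNextOdd (3 * m + 1) = 4 * m + 1 := by
  unfold revNextOdd
  split_ifs <;> omega

theorem revOddSeq_three_pow_mul_add_one (i m : ℕ) :
    revOddSeq (3 ^ i * m + 1) i = 4 ^ i * m + 1 := by
  induction i generalizing m with
  | zero => simp [revOddSeq]
  | succ i ih =>
    have h := ih (4 * m)
    unfold revOddSeq at h ⊢
    rw [Function.iterate_succ_apply, pow_succ', mul_assoc, revNextOdd_three_mul_add_one,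
      mul_left_comm, h]
    ring

theorem revOddSeq_mul_three_pow_mul_add_one (c B : ℕ) {i n : ℕ} (hi : i ≤ n) :
    revOddSeq (c * (3 ^ n * B) + 1) i = 4 ^ i * c * 3 ^ (n - i) * B + 1 := by
  have h : c * (3 ^ n * B) = 3 ^ i * (c * 3 ^ (n - i) * B) := by
    rw [← pow_mul_pow_sub 3 hi]
    ring
  rw [h, revOddSeq_three_pow_mul_add_one]
  ring

theorem stmt8 (A n B : ℕ) (hA : Odd A) (hn : 1 ≤ n) (hB : Odd B)
    (hB3 : ¬ (3 ∣ B)) (hAB : A = 3 ^ n * B) :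
    (∀ i, 1 ≤ i → i ≤ n →
      revOddSeq (2 * A + 1) i = 2 ^ (2 * i + 1) * 3 ^ (n - i) * B + 1 ∧
      revOddSeq (4 * A + 1) i = 2 ^ (2 * i + 2) * 3 ^ (n - i) * B + 1) ∧
    (B % 3 = 1 → revOddSeq (2 * A + 1) n % 3 = 0) ∧
    (B % 3 = 2 → revOddSeq (4 * A + 1) n % 3 = 0) := by
  subst hAB
  have four_pow_mod (k : ℕ) : 4 ^ k % 3 = 1 := by simp [Nat.pow_mod]
  refine ⟨fun i _ hi => ?_, fun h => ?_, fun h => ?_⟩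
  · rw [revOddSeq_mul_three_pow_mul_add_one 2 B hi, revOddSeq_mul_three_pow_mul_add_one 4 B hi,
      pow_add, pow_add, pow_mul]
    norm_num
  · rw [revOddSeq_mul_three_pow_mul_add_one 2 B le_rfl]
    simp [Nat.add_mod, Nat.mul_mod, four_pow_mod, h]
  · rw [revOddSeq_mul_three_pow_mul_add_one 4 B le_rfl]
    simp [Nat.add_mod, Nat.mul_mod, four_pow_mod, h]
end

section
/- Let A be an odd number with A ≡ 2 mod 3. Let p_i and q_i denote the sequences of odd numbers in the reverse Collatz sequences of A and 2A + 1 respectively, and let k ≥ 1 be the smallest index such that p_k ≢ 2 mod 3. Then: the reverse Collatz sequence of 4A + 1 is trivial (since 4A + 1 ≡ 0 mod 3); the reverse Collatz sequences of A and of 2A + 1 are both not trivial; q_i = 2p_i + 1 for 0 ≤ i ≤ k; if p_k ≡ 0 mod 3, then q_{k+1} = 2^3·(p_k/3) + 1; and if p_k ≡ 1 mod 3, then q_k ≡ 0 mod 3. -/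
theorem revStep_iterate_of_three_dvd {a : ℕ} (ha : a % 3 = 0) (i : ℕ) :
    revStep^[i] a = 2 ^ i * a := by
  induction i with
  | zero => simp
  | succ i ih =>
    have h : (2 ^ i * a) % 3 = 0 := by simp [Nat.mul_mod, ha]
    rw [Function.iterate_succ_apply', ih, revStep, if_neg (by omega), pow_succ]
    ring

theorem revTrivial_of_three_dvd {a : ℕ} (ha : a % 3 = 0) : revTrivial a := by
  intro i hi
  rw [revStep_iterate_of_three_dvd ha] at hi ⊢
  cases i with
  | zero => simp
  | succ i =>
    rw [pow_succ, mul_right_comm] at hi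
    exact absurd hi (by simp [Nat.odd_mul])

theorem not_revTrivial_of_mod_three_eq_two {a : ℕ} (ha : Odd a) (ha3 : a % 3 = 2) :
    ¬ revTrivial a := by
  intro h
  obtain ⟨m, rfl⟩ := ha
  have h1 : revStep (2 * m + 1) = 2 * (2 * m + 1) :=
    if_neg (by omega)
  have h2 : revStep (2 * (2 * m + 1)) = (2 * (2 * m + 1) - 1) / 3 :=
    if_pos ⟨even_two_mul _, by omega⟩
  have h3 : revStep^[2] (2 * m + 1) = (2 * (2 * m + 1) - 1) / 3 := by
    rw [Function.iterate_succ_apply, Function.iterate_one, h1, h2]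
  have h4 := h 2 (by rw [h3, Nat.odd_iff]; omega)
  omega

theorem revOddSeq_succ (a i : ℕ) : revOddSeq a (i + 1) = revNextOdd (revOddSeq a i) :=
  Function.iterate_succ_apply' _ _ _

theorem revNextOdd_two_mul_add_one {p : ℕ} (hp : p % 3 = 2) :
    revNextOdd (2 * p + 1) = 2 * revNextOdd p + 1 := by
  simp only [revNextOdd]
  split_ifs <;> omega

theorem revOddSeq_two_mul_add_one {a k : ℕ} (h : ∀ i < k, revOddSeq a i % 3 = 2) :
    ∀ i ≤ k, revOddSeq (2 * a + 1) i = 2 * revOddSeq a i + 1 := by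
  intro i hi
  induction i with
  | zero => rfl
  | succ i ih =>
    rw [revOddSeq_succ, revOddSeq_succ, ih (by omega), revNextOdd_two_mul_add_one (h i hi)]

theorem stmt11 (A k : ℕ) (hA : Odd A) (hA3 : A % 3 = 2) (hk : 1 ≤ k)
    (hknot2 : revOddSeq A k % 3 ≠ 2)
    (hkmin : ∀ i, 1 ≤ i → i < k → revOddSeq A i % 3 = 2) :
    (4 * A + 1) % 3 = 0 ∧ revTrivial (4 * A + 1) ∧
    ¬ revTrivial A ∧ ¬ revTrivial (2 * A + 1) ∧
    (∀ i, i ≤ k → revOddSeq (2 * A + 1) i = 2 * revOddSeq A i + 1) ∧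
    (revOddSeq A k % 3 = 0 →
      revOddSeq (2 * A + 1) (k + 1) = 2 ^ 3 * (revOddSeq A k / 3) + 1) ∧
    (revOddSeq A k % 3 = 1 → revOddSeq (2 * A + 1) k % 3 = 0) := by
  have hseq := revOddSeq_two_mul_add_one (a := A) (k := k) fun i hi => by
    rcases Nat.eq_zero_or_pos i with rfl | h0
    · exact hA3
    · exact hkmin i h0 hi
  refine ⟨by omega, revTrivial_of_three_dvd (by omega),
    not_revTrivial_of_mod_three_eq_two hA hA3,
    not_revTrivial_of_mod_three_eq_two (odd_two_mul_add_one A) (by omega), hseq, ?_, ?_⟩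
  · intro h
    rw [revOddSeq_succ, hseq k le_rfl, revNextOdd, if_neg (by omega)]
    omega
  · intro h
    rw [hseq k le_rfl]
    omega
end

section
/- For every odd positive integer A, at least one of the reverse Collatz sequences of A and of 4A + 1 converges; that is, the subsequence of odd numbers of the reverse Collatz sequence of A, or that of 4A + 1, reaches a multiple of 3. -/
theorem revConverges_of_three_dvd {a : ℕ} (ha : Odd a) (h : 3 ∣ a) : revConverges a :=
  ⟨0, ha, h⟩

theorem revConverges_of_revStep {a : ℕ} (h : revConverges (revStep a)) : revConverges a :=
  let ⟨i, hi⟩ := h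
  ⟨i + 1, hi⟩

theorem revStep_of_odd {a : ℕ} (ha : Odd a) : revStep a = 2 * a :=
  if_neg fun h => Nat.not_even_iff_odd.2 ha h.1

theorem revConverges_of_two_mul_eq {a b : ℕ} (ha : Odd a) (hab : 2 * a = 3 * b + 1)
    (h : revConverges b) : revConverges a := by
  apply revConverges_of_revStep
  rw [revStep_of_odd ha]
  apply revConverges_of_revStep
  rw [revStep, if_pos ⟨even_two_mul a, by omega⟩]
  rwa [show (2 * a - 1) / 3 = b by omega]

theorem revConverges_of_four_mul_eq {a b : ℕ} (ha : Odd a) (hab : 4 * a = 3 * b + 1)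
    (h : revConverges b) : revConverges a := by
  apply revConverges_of_revStep
  rw [revStep_of_odd ha]
  apply revConverges_of_revStep
  rw [revStep, if_neg (by omega)]
  apply revConverges_of_revStep
  rw [revStep, if_pos ⟨even_two_mul _, by omega⟩]
  rwa [show (2 * (2 * a) - 1) / 3 = b by omega]

theorem revConverges_or_two_mul_add_one (b : ℕ) (hb : Odd b) :
    revConverges b ∨ revConverges (2 * b + 1) := by
  induction b using Nat.strong_induction_on with
  | _ b ih =>
    have hodd : Odd (2 * b + 1) := odd_two_mul_add_one b
    have hb' := Nat.odd_iff.1 hb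
    have h3 : b % 3 = 0 ∨ b % 3 = 1 ∨ b % 3 = 2 := by omega
    rcases h3 with h | h | h
    · exact .inl (revConverges_of_three_dvd hb (by omega))
    · exact .inr (revConverges_of_three_dvd hodd (by omega))
    · obtain ⟨c, hc⟩ : ∃ c, 2 * b = 3 * c + 1 := ⟨(2 * b - 1) / 3, by omega⟩
      exact (ih c (by omega) (Nat.odd_iff.2 (by omega))).imp
        (revConverges_of_two_mul_eq hb hc)
        (revConverges_of_two_mul_eq hodd (by omega))

theorem stmt12 (A : ℕ) (hA : Odd A) (hApos : 0 < A) :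
    revConverges A ∨ revConverges (4 * A + 1) := by
  have hodd : Odd (4 * A + 1) := Nat.odd_iff.2 (by omega)
  have h3 : A % 3 = 0 ∨ A % 3 = 1 ∨ A % 3 = 2 := by omega
  rcases h3 with h | h | h
  · exact .inl (revConverges_of_three_dvd hA (by omega))
  · obtain ⟨b, hb⟩ : ∃ b, 4 * A = 3 * b + 1 := ⟨(4 * A - 1) / 3, by omega⟩
    exact (revConverges_or_two_mul_add_one b (Nat.odd_iff.2 (by omega))).imp
      (revConverges_of_four_mul_eq hA (by omega))
      (revConverges_of_two_mul_eq hodd (by omega))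
  · exact .inr (revConverges_of_three_dvd hodd (by omega))
end

section
/- Let n ≥ 0 with n ≢ 1 mod 3. Define u_0 = 4n + 1 and u_i = 2u_{i-1} + 1 for i ≥ 1; define v_{0,j} = u_j for j ≥ 0, v_{k,k} = 3v_{k-1,k-1} + 2 for k ≥ 1, and v_{i,j} = 2v_{i,j-1} + 1 for j > i ≥ 1. Then: (i) u_k ≢ 2 mod 3 for all k ≥ 0, while v_{i,j} ≡ 2 mod 3 whenever j ≥ i ≥ 1; (ii) u_0 ≡ 1 mod 4 and v_{i,i} ≡ 1 mod 4 for all i ≥ 0, while u_i ≢ 1 mod 4 for i > 0 and v_{i,j} ≢ 1 mod 4 whenever j > i; (iii) for i ≥ 0, if u_i ≡ 1 mod 3 then u_{i+1} ≡ 0 mod 3, and if u_i ≡ 0 mod 3 then u_{i+1} ≡ 1 mod 3. -/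
theorem stmt16 (n : ℕ) (hn : n % 3 ≠ 1)
    (u : ℕ → ℕ) (hu0 : u 0 = 4 * n + 1) (hu : ∀ i, u (i + 1) = 2 * u i + 1)
    (v : ℕ → ℕ → ℕ) (hv0 : ∀ j, v 0 j = u j)
    (hvd : ∀ k, v (k + 1) (k + 1) = 3 * v k k + 2)
    (hvr : ∀ i j, 1 ≤ i → i ≤ j → v i (j + 1) = 2 * v i j + 1) :
    (∀ k, u k % 3 ≠ 2) ∧
    (∀ i j, 1 ≤ i → i ≤ j → v i j % 3 = 2) ∧
    u 0 % 4 = 1 ∧ (∀ i, v i i % 4 = 1) ∧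
    (∀ i, 1 ≤ i → u i % 4 ≠ 1) ∧
    (∀ i j, i < j → v i j % 4 ≠ 1) ∧
    (∀ i, u i % 3 = 1 → u (i + 1) % 3 = 0) ∧
    (∀ i, u i % 3 = 0 → u (i + 1) % 3 = 1) := by
  have hu3 : ∀ k, u k % 3 ≠ 2 := by
    intro k
    induction k with
    | zero => omega
    | succ k ih => have := hu k; omega
  have hu_odd : ∀ k, u k % 2 = 1 := by
    intro k
    cases k with
    | zero => omega
    | succ k => have := hu k; omega
  have hu4 : ∀ i, 1 ≤ i → u i % 4 ≠ 1 := by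
    intro i hi
    obtain ⟨k, rfl⟩ := Nat.exists_eq_add_of_le' hi
    have := hu k
    have := hu_odd k
    omega
  have hv_diag : ∀ i, v i i % 4 = 1 := by
    intro i
    induction i with
    | zero => have := hv0 0; omega
    | succ k ih => have := hvd k; omega
  have hv3 : ∀ i j, 1 ≤ i → i ≤ j → v i j % 3 = 2 := by
    intro i j hi hij
    induction j, hij using Nat.le_induction with
    | base =>
      obtain ⟨k, rfl⟩ := Nat.exists_eq_add_of_le' hi
      have := hvd k
      omega
    | succ j hij ih => have := hvr i j hi hij; omega
  have hv4 : ∀ i j, i < j → v i j % 4 ≠ 1 := by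
    intro i j hij
    rcases Nat.eq_zero_or_pos i with rfl | hi
    · rw [hv0]
      exact hu4 j hij
    · have h : v i j % 4 = 3 := by
        induction j, (show i + 1 ≤ j from hij) using Nat.le_induction with
        | base =>
          have := hvr i i hi le_rfl
          have := hv_diag i
          omega
        | succ j hj ih =>
          have := hvr i j hi (by omega)
          have := ih (by omega)
          omega
      omega
  refine ⟨hu3, hv3, by omega, hv_diag, hu4, hv4, ?_, ?_⟩ <;>
    · intro i hi
      have := hu i
      omega
end

section
/- Let n ≥ 0 with n ≢ 1 mod 3. Define u_0 = 4n + 1 and u_i = 2u_{i-1} + 1 for i ≥ 1; define v_{0,j} = u_j for j ≥ 0, v_{k,k} = 3v_{k-1,k-1} + 2 for k ≥ 1, and v_{i,j} = 2v_{i,j-1} + 1 for j > i ≥ 1. Then for every j ≥ 1 and every i with 0 ≤ i < j, v_{i+1,j} = (3v_{i,j} + 1)/2 and v_{i+1,j} is the odd number that comes after v_{i,j} in the Collatz sequence of v_{i,j}; consequently the j-th column v_{0,j}, v_{1,j}, ..., v_{j,j} consists of the first j + 1 odd numbers in the Collatz sequence of u_j. -/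
theorem nextOdd_eq_of_two_mul_eq {a b : ℕ} (hb : Odd b) (h : 3 * a + 1 = 2 * b) :
    nextOdd a = b := by
  have hb2 : ¬ 2 ∣ b := hb.not_two_dvd_nat
  have hf : (2 * b).factorization 2 = 1 := by
    rw [Nat.factorization_mul two_ne_zero hb.pos.ne', Finsupp.add_apply,
      Nat.prime_two.factorization_self, Nat.factorization_eq_zero_of_not_dvd hb2]
  rw [nextOdd, h, hf, pow_one, Nat.mul_div_cancel_left b two_pos]

theorem stmt17 (n : ℕ) (hn : n % 3 ≠ 1)
    (u : ℕ → ℕ) (hu0 : u 0 = 4 * n + 1) (hu : ∀ i, u (i + 1) = 2 * u i + 1)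
    (v : ℕ → ℕ → ℕ) (hv0 : ∀ j, v 0 j = u j)
    (hvd : ∀ k, v (k + 1) (k + 1) = 3 * v k k + 2)
    (hvr : ∀ i j, 1 ≤ i → i ≤ j → v i (j + 1) = 2 * v i j + 1) :
    ∀ j, 1 ≤ j →
      (∀ i, i < j →
        v (i + 1) j = (3 * v i j + 1) / 2 ∧ v (i + 1) j = nextOdd (v i j)) ∧
      (∀ i, i ≤ j → v i j = oddSeq (u j) i) := by
  have hr : ∀ i j, i ≤ j → v i (j + 1) = 2 * v i j + 1 := by
    intro i j hij
    rcases Nat.eq_zero_or_pos i with rfl | hi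
    · rw [hv0, hv0, hu]
    · exact hvr i j hi hij
  have hdiag : ∀ k, Odd (v k k) := by
    intro k
    induction k with
    | zero => rw [hv0, hu0]; exact ⟨2 * n, by ring⟩
    | succ k ih =>
      obtain ⟨m, hm⟩ := ih
      exact ⟨3 * m + 2, by rw [hvd, hm]; ring⟩
  have hodd : ∀ i j, i ≤ j → Odd (v i j) := by
    intro i j hij
    induction j, hij using Nat.le_induction with
    | base => exact hdiag i
    | succ j hij _ => exact ⟨v i j, hr i j hij⟩
  have hstep : ∀ i j, i ≤ j → v (i + 1) (j + 1) = 3 * v i j + 2 := by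
    intro i j hij
    induction j, hij using Nat.le_induction with
    | base => exact hvd i
    | succ j hij ih =>
      rw [hr (i + 1) (j + 1) (by omega), ih, hr i j hij]
      ring
  have hdouble : ∀ i j, i < j → 3 * v i j + 1 = 2 * v (i + 1) j := by
    intro i j hij
    obtain ⟨k, rfl⟩ : ∃ k, j = k + 1 := ⟨j - 1, by omega⟩
    rw [hstep i k (by omega), hr i k (by omega)]
    ring
  have hnext : ∀ i j, i < j → nextOdd (v i j) = v (i + 1) j := fun i j hij =>
    nextOdd_eq_of_two_mul_eq (hodd (i + 1) j hij) (hdouble i j hij)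
  intro j _
  refine ⟨fun i hij => ⟨?_, (hnext i j hij).symm⟩, fun i => ?_⟩
  · rw [hdouble i j hij, Nat.mul_div_cancel_left _ two_pos]
  · induction i with
    | zero => exact fun _ => hv0 j
    | succ i ih =>
      intro hij
      rw [oddSeq, Function.iterate_succ_apply', ← oddSeq, ← ih (by omega), hnext i j hij]
end

section
/- Every odd positive integer occurs in one of the diagonal arrays: for every odd m there exist n ≥ 0 with n ≢ 1 mod 3 and indices i, j with 0 ≤ i ≤ j such that m = v_{i,j} in the array associated to n, where the array is defined by u_0 = 4n + 1, u_i = 2u_{i-1} + 1 for i ≥ 1, v_{0,j} = u_j for j ≥ 0, v_{k,k} = 3v_{k-1,k-1} + 2 for k ≥ 1, and v_{i,j} = 2v_{i,j-1} + 1 for j > i ≥ 1. -/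
/-- The diagonal entries of the array associated to `n`:
`vDiag n 0 = u_0 = 4n+1` and `vDiag n (k+1) = 3 * vDiag n k + 2`. -/
def vDiag (n : ℕ) : ℕ → ℕ
  | 0 => 4 * n + 1
  | k + 1 => 3 * vDiag n k + 2

/-- The entry `v_{i,j}` (for `i ≤ j`) of the diagonal array associated to `n`.
This closed form satisfies the defining recurrences:
`vArr n 0 j = u_j` where `u_0 = 4n+1`, `u_{j+1} = 2u_j + 1`;
`vArr n k k = vDiag n k` with `vArr n (k+1) (k+1) = 3 * vArr n k k + 2`; and
`vArr n i (j+1) = 2 * vArr n i j + 1` for `j ≥ i`. -/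
def vArr (n i j : ℕ) : ℕ := 2 ^ (j - i) * vDiag n i + (2 ^ (j - i) - 1)

theorem vDiag_add_one (n k : ℕ) : vDiag n k + 1 = 3 ^ k * (2 * (2 * n + 1)) := by
  induction k with
  | zero => simp only [vDiag]; ring
  | succ k ih =>
    calc vDiag n (k + 1) + 1 = 3 * (vDiag n k + 1) := by simp only [vDiag]; ring
      _ = 3 ^ (k + 1) * (2 * (2 * n + 1)) := by rw [ih]; ring

theorem vArr_add_one (n i j : ℕ) :
    vArr n i j + 1 = 2 ^ (j - i + 1) * (3 ^ i * (2 * n + 1)) := by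
  have hpos : 1 ≤ 2 ^ (j - i) := Nat.one_le_two_pow
  calc vArr n i j + 1 = 2 ^ (j - i) * (vDiag n i + 1) := by
        rw [vArr, add_assoc, Nat.sub_add_cancel hpos]; ring
    _ = 2 ^ (j - i + 1) * (3 ^ i * (2 * n + 1)) := by rw [vDiag_add_one]; ring

theorem stmt19 (m : ℕ) (hm : Odd m) (hmpos : 0 < m) :
    ∃ n i j, n % 3 ≠ 1 ∧ i ≤ j ∧ vArr n i j = m := by
  obtain ⟨e, q, hq, hmq⟩ := Nat.exists_eq_two_pow_mul_odd (n := m + 1) (by omega)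
  obtain ⟨k, r, hr, rfl⟩ := Nat.exists_eq_pow_mul_and_not_dvd hq.pos.ne' 3 (by norm_num)
  obtain ⟨n, rfl⟩ := (Nat.odd_mul.mp hq).2
  obtain _ | a := e
  · rw [pow_zero, one_mul] at hmq
    exact absurd (hmq ▸ hm.add_one) (Nat.not_even_iff_odd.mpr hq)
  · refine ⟨n, k, k + a, by omega, Nat.le_add_right k a, ?_⟩
    have h := vArr_add_one n k (k + a)
    rw [Nat.add_sub_cancel_left, ← hmq] at h
    exact Nat.succ_injective h
end
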